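/- arXiv:1301.0792 — 3 statements merged into one kernel-verified Lean document; each statement's English description precedes it below -/
import Mathlib

section
/- Consider commutative rings R, R1, R2, R12 with ring homomorphisms R → R1 → R12 and R → R2 → R12 forming a commuting square such that the sequence 0 → R → R1 ⊕ R2 → R12 → 0 is exact, where R → R1 ⊕ R2 sends r to the pair of its images and R1 ⊕ R2 → R12 sends (x, y) to the difference of the images of x and y. Suppose that for every glueing datum (M1, M2, M12, ψ1, ψ2) over this square in which M1, M2, M12 are finitely generated over R1, R2, R12 respectively, there exists a finitely generated R-submodule M0 of M such that the natural map M0 ⊗_R R1 → M1 is surjective. Then for every glueing datum in which M1, M2, M12 are finite projective modules over R1, R2, R12 respectively, the R-module M is finitely presented, and the natural maps M ⊗_R R1 → M1 and M ⊗_R R2 → M2 are bijective. -/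
open TensorProduct

universe u v w

section TraceIdeal

variable {A B M M' : Type*} [CommRing A] [CommRing B] [Algebra A B]
  [AddCommGroup M] [Module A M] [AddCommGroup M'] [Module B M']

/-- The ideal generated by all values of linear functionals on `M`. -/
def traceIdeal (A M : Type*) [CommRing A] [AddCommGroup M] [Module A M] : Ideal A :=
  Ideal.span {a | ∃ (f : M →ₗ[A] A) (m : M), f m = a}

theorem mul_eq_zero_of_mem_traceIdeal {a t : A} (ha : ∀ m : M, a • m = 0)
    (ht : t ∈ traceIdeal A M) : a * t = 0 := by
  induction ht using Submodule.span_induction with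
  | mem x hx =>
    obtain ⟨f, m, rfl⟩ := hx
    rw [← smul_eq_mul, ← map_smul, ha, map_zero]
  | zero => simp
  | add x y _ _ hx hy => rw [mul_add, hx, hy, add_zero]
  | smul c x _ hx => rw [smul_eq_mul, mul_left_comm, hx, mul_zero]

theorem exists_mem_traceIdeal_smul_eq_self [Module.Finite A M] [Module.Projective A M] :
    ∃ e ∈ traceIdeal A M, ∀ m : M, e • m = m := by
  obtain ⟨s, hs⟩ := Module.projective_def'.mp ‹Module.Projective A M›
  have hle : (⊤ : Submodule A M) ≤ traceIdeal A M • ⊤ := by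
    intro m _
    have hm : Finsupp.linearCombination A id (s m) = m := LinearMap.congr_fun hs m
    rw [← hm, Finsupp.linearCombination_apply]
    refine Submodule.sum_mem _ fun x _ ↦ Submodule.smul_mem_smul ?_ trivial
    exact Ideal.subset_span ⟨Finsupp.lapply x ∘ₗ s, m, rfl⟩
  obtain ⟨r, hr, hr'⟩ := Submodule.exists_sub_one_mem_and_smul_eq_zero_of_fg_of_le_smul
    _ _ Module.Finite.fg_top hle
  refine ⟨1 - r, by simpa using neg_mem hr, fun m ↦ ?_⟩
  rw [sub_smul, one_smul, hr' m trivial, sub_zero]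

theorem algebraMap_mem_traceIdeal (ψ : (B ⊗[A] M) ≃ₗ[B] M') {t : A}
    (ht : t ∈ traceIdeal A M) : algebraMap A B t ∈ traceIdeal B M' := by
  induction ht using Submodule.span_induction with
  | mem x hx =>
    obtain ⟨f, m, rfl⟩ := hx
    exact Ideal.subset_span
      ⟨(Algebra.linearMap A B ∘ₗ f).liftBaseChange B ∘ₗ ψ.symm.toLinearMap, ψ (1 ⊗ₜ m), by simp⟩
  | zero => simp
  | add x y _ _ hx hy => rw [map_add]; exact add_mem hx hy
  | smul c x _ hx => rw [smul_eq_mul, map_mul]; exact Ideal.mul_mem_left _ _ hx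

theorem algebraMap_smul_eq_self (ψ : (B ⊗[A] M) ≃ₗ[B] M') {e : A}
    (he : ∀ m : M, e • m = m) (x : M') : algebraMap A B e • x = x := by
  obtain ⟨x, rfl⟩ := ψ.surjective x
  rw [← map_smul]
  congr 1
  induction x using TensorProduct.induction_on with
  | zero => simp
  | tmul b m => rw [algebraMap_smul, ← tmul_smul, he]
  | add x y hx hy => rw [smul_add, hx, hy]

theorem eq_mul_of_mem_traceIdeal {e f : A} (he : ∀ m : M, e • m = m)
    (hf : f ∈ traceIdeal A M) : f = e * f := by
  have := mul_eq_zero_of_mem_traceIdeal (M := M) (a := 1 - e)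
    (fun m ↦ by rw [sub_smul, one_smul, he, sub_self]) hf
  linear_combination this

end TraceIdeal

section Relations

variable {R A M ι : Type*} [CommRing R] [CommRing A] [Algebra R A] [AddCommGroup M] [Module A M]
  [Fintype ι]

/-- The linear relations over `A` among the vectors `m i` whose coefficients are fixed by `e`. -/
def relations (A : Type*) [CommRing A] [Algebra R A] [Module A M] (e : R) (m : ι → M) :
    Submodule A (ι → A) where
  carrier := {x | e • x = x ∧ ∑ i, x i • m i = 0}
  zero_mem' := by simp
  add_mem' := by
    rintro x y ⟨hx, hx'⟩ ⟨hy, hy'⟩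
    exact ⟨by rw [smul_add, hx, hy],
      by simp only [Pi.add_apply, add_smul, Finset.sum_add_distrib, hx', hy', add_zero]⟩
  smul_mem' := by
    rintro c x ⟨hx, hx'⟩
    refine ⟨by rw [smul_comm, hx], ?_⟩
    simp only [Pi.smul_apply, smul_eq_mul, mul_smul, ← Finset.smul_sum, hx', smul_zero]

theorem smul_mem_relations {e : R} (he : e * e = e) {m : ι → M} {x : ι → A}
    (hx : ∑ i, x i • m i = 0) : e • x ∈ relations A e m := by
  refine ⟨by rw [smul_smul, he], ?_⟩
  simp_rw [← algebraMap_smul A e x, Pi.smul_apply, smul_assoc, ← Finset.smul_sum, hx, smul_zero]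

theorem small_relations {ι : Type} [Fintype ι] [Small.{v} M] {e : R} (m : ι → M)
    (hann : ∀ a : A, (∀ y : M, a • y = 0) → e • a = 0) : Small.{v} (relations A e m) := by
  refine small_of_injective (β := ι → M → M) (f := fun x i y ↦ x.1 i • y) fun x x' h ↦ ?_
  ext i
  have key := hann (x.1 i - x'.1 i) fun y ↦ by
    rw [sub_smul, sub_eq_zero]; exact congr_fun (congr_fun h i) y
  have h1 : e • x.1 i = x.1 i := congr_fun x.2.1 i
  have h2 : e • x'.1 i = x'.1 i := congr_fun x'.2.1 i
  rwa [smul_sub, h1, h2, sub_eq_zero] at key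

theorem exists_retraction_relations [Module.Projective A M] {e : R} (he : e * e = e) {m : ι → M}
    (hm : Submodule.span A (Set.range m) = ⊤) :
    ∃ (s : M →ₗ[A] ι → A) (p : (ι → A) →ₗ[A] relations A e m),
      (∀ x : relations A e m, p x = x) ∧
      ∀ x, (p x : ι → A) = e • (x - s (∑ i, x i • m i)) := by
  obtain ⟨s, hs⟩ := Module.projective_lifting_property (Fintype.linearCombination A m)
    (LinearMap.id : M →ₗ[A] M)
    (LinearMap.range_eq_top.mp (by rw [Fintype.range_linearCombination, hm]))
  have hs' (y : M) : ∑ i, s y i • m i = y := by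
    simpa [Fintype.linearCombination_apply] using LinearMap.congr_fun hs y
  let q : (ι → A) →ₗ[A] (ι → A) :=
    algebraMap R A e • (LinearMap.id - s ∘ₗ Fintype.linearCombination A m)
  have hq (x : ι → A) : q x = e • (x - s (∑ i, x i • m i)) := by
    simp [q, Fintype.linearCombination_apply]
  refine ⟨s, q.codRestrict _ fun x ↦ ?_, fun x ↦ Subtype.ext ?_, hq⟩
  · rw [hq]
    refine smul_mem_relations he ?_
    simp only [Pi.sub_apply, sub_smul, Finset.sum_sub_distrib, hs', sub_self]
  · change q x = x
    rw [hq, x.2.2, map_zero, sub_zero, x.2.1]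

theorem finite_relations [Module.Projective A M] {e : R} (he : e * e = e) {m : ι → M}
    (hm : Submodule.span A (Set.range m) = ⊤) : Module.Finite A (relations A e m) := by
  obtain ⟨_, p, hp, -⟩ := exists_retraction_relations he hm
  exact Module.Finite.of_surjective p fun x ↦ ⟨x, hp x⟩

theorem projective_relations [Module.Projective A M] {e : R} (he : e * e = e) {m : ι → M}
    (hm : Submodule.span A (Set.range m) = ⊤) : Module.Projective A (relations A e m) := by
  obtain ⟨_, p, hp, -⟩ := exists_retraction_relations he hm
  exact Module.Projective.of_split (relations A e m).subtype p (LinearMap.ext hp)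

variable {B M' : Type*} [CommRing B] [Algebra R B] [Algebra A B] [IsScalarTower R A B]
  [AddCommGroup M'] [Module B M']

theorem algebraMap_comp_mem_relations (ψ : (B ⊗[A] M) ≃ₗ[B] M') {e : R} {m : ι → M} {m' : ι → M'}
    (hm' : ∀ i, m' i = ψ (1 ⊗ₜ m i)) {x : ι → A} (hx : x ∈ relations A e m) :
    (fun i ↦ algebraMap A B (x i)) ∈ relations B e m' := by
  refine ⟨funext fun i ↦ ?_, ?_⟩
  · have := congr_arg (algebraMap A B) (congr_fun hx.1 i)
    rwa [Pi.smul_apply, Algebra.smul_def, map_mul, ← IsScalarTower.algebraMap_apply,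
      ← Algebra.smul_def] at this
  · simp_rw [hm', ← map_smul, ← map_sum, algebraMap_smul, ← tmul_smul, ← tmul_sum, hx.2,
      tmul_zero, map_zero]

theorem exists_baseChange_relations_equiv [Module.Projective A M] (ψ : (B ⊗[A] M) ≃ₗ[B] M') {e : R}
    (he : e * e = e) {m : ι → M} {m' : ι → M'} (hm : Submodule.span A (Set.range m) = ⊤)
    (hm' : ∀ i, m' i = ψ (1 ⊗ₜ m i)) :
    ∃ Φ : (B ⊗[A] relations A e m) ≃ₗ[B] relations B e m',
      ∀ (x : relations A e m) (i : ι), (Φ (1 ⊗ₜ x)).1 i = algebraMap A B (x.1 i) := by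
  classical
  obtain ⟨s, p, hp, hps⟩ := exists_retraction_relations he hm
  let g : relations A e m →ₗ[A] relations B e m' :=
    { toFun := fun x ↦ ⟨_, algebraMap_comp_mem_relations ψ hm' x.2⟩
      map_add' := fun x y ↦ by ext i; simp
      map_smul' := fun c x ↦ by ext i; simp [Algebra.smul_def] }
  have hg (x : relations A e m) (i : ι) : (g x).1 i = algebraMap A B (x.1 i) := rfl
  let π := TensorProduct.piScalarRight A B B ι
  have hinj : Function.Injective (g.liftBaseChange B) := by
    have h1 (t : B ⊗[A] relations A e m) :
        (g.liftBaseChange B t).1 = π ((relations A e m).subtype.baseChange B t) := by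
      induction t using TensorProduct.induction_on with
      | zero => simp
      | tmul b x => ext i; simp [π, hg, Algebra.smul_def, mul_comm]
      | add x y hx hy => simp only [map_add, ← hx, ← hy]; rfl
    have h2 (t : B ⊗[A] relations A e m) :
        p.baseChange B ((relations A e m).subtype.baseChange B t) = t := by
      rw [← LinearMap.comp_apply, ← LinearMap.baseChange_comp,
        show p ∘ₗ (relations A e m).subtype = LinearMap.id from LinearMap.ext hp,
        LinearMap.baseChange_id, LinearMap.id_apply]
    intro t t' h
    rw [← h2 t, ← h2 t', π.injective ((h1 t).symm.trans ((congr_arg _ h).trans (h1 t')))]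
  have h3 (t : B ⊗[A] (ι → A)) : (g.liftBaseChange B (p.baseChange B t)).1 =
      e • (π t - π (s.baseChange B ((Fintype.linearCombination A m).baseChange B t))) := by
    induction t using TensorProduct.induction_on with
    | zero => simp
    | tmul b x =>
      ext i
      simp [π, hg, hps, Fintype.linearCombination_apply, Algebra.smul_def,
        ← IsScalarTower.algebraMap_apply]
      ring
    | add x y hx hy =>
      simp only [map_add, Submodule.coe_add, hx, hy]
      rw [← smul_add]
      congr 1
      abel
  have h4 (t : B ⊗[A] (ι → A)) :
      ψ ((Fintype.linearCombination A m).baseChange B t) = ∑ i, π t i • m' i := by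
    induction t using TensorProduct.induction_on with
    | zero => simp
    | tmul b x =>
      rw [LinearMap.baseChange_tmul, Fintype.linearCombination_apply, tmul_sum, map_sum]
      refine Finset.sum_congr rfl fun i _ ↦ ?_
      rw [hm', ← map_smul, smul_tmul', smul_eq_mul, mul_one, tmul_smul, smul_tmul',
        piScalarRight_apply, piScalarRightHom_tmul]
    | add x y hx hy => simp only [map_add, hx, hy, Pi.add_apply, add_smul, Finset.sum_add_distrib]
  have hsurj : Function.Surjective (g.liftBaseChange B) := by
    intro y
    refine ⟨p.baseChange B (π.symm y.1), Subtype.ext ?_⟩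
    have h5 : (Fintype.linearCombination A m).baseChange B (π.symm y.1) = 0 :=
      ψ.injective (by rw [h4, π.apply_symm_apply, y.2.2, map_zero])
    rw [h3, h5, map_zero, map_zero, sub_zero, π.apply_symm_apply, y.2.1]
  have hbij : Function.Bijective (g.liftBaseChange B) := ⟨hinj, hsurj⟩
  refine ⟨.ofBijective _ hbij, fun x i ↦ ?_⟩
  rw [LinearEquiv.ofBijective_apply, LinearMap.liftBaseChange_one_tmul, hg]

end Relations

section BaseChange

theorem equiv_one_tmul_smul {A B M M' : Type*} [CommRing A] [CommRing B] [Algebra A B]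
    [AddCommGroup M] [Module A M] [AddCommGroup M'] [Module B M']
    (ψ : (B ⊗[A] M) ≃ₗ[B] M') (a : A) (x : M) :
    ψ (1 ⊗ₜ (a • x)) = algebraMap A B a • ψ (1 ⊗ₜ x) := by
  rw [← map_smul, algebraMap_smul, tmul_smul]

theorem equiv_one_tmul_sum_smul {A B M M' ι : Type*} [CommRing A] [CommRing B] [Algebra A B]
    [AddCommGroup M] [Module A M] [AddCommGroup M'] [Module B M'] [Fintype ι]
    (ψ : (B ⊗[A] M) ≃ₗ[B] M') (a : ι → A) (m : ι → M) :
    ψ (1 ⊗ₜ (∑ i, a i • m i)) = ∑ i, algebraMap A B (a i) • ψ (1 ⊗ₜ m i) := by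
  simp_rw [tmul_sum, map_sum, equiv_one_tmul_smul]

theorem liftBaseChange_injective_of_relations {R A M N ι : Type*} [CommRing R] [CommRing A]
    [Algebra R A] [AddCommGroup M] [Module R M] [AddCommGroup N] [Module R N] [Module A N]
    [IsScalarTower R A N] [Fintype ι] (g : M →ₗ[R] N) {m : ι → M}
    (hm : Submodule.span R (Set.range m) = ⊤)
    (hrel : ∀ x : ι → A, ∑ i, x i • g (m i) = 0 → x ∈ Submodule.span A
      {y | ∃ r : ι → R, ∑ i, r i • m i = 0 ∧ y = fun i ↦ algebraMap R A (r i)}) :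
    Function.Injective (g.liftBaseChange A) := by
  let θ : (ι → A) →ₗ[A] A ⊗[R] M := Fintype.linearCombination A fun i ↦ 1 ⊗ₜ m i
  have hθ (x : ι → A) : θ x = ∑ i, x i ⊗ₜ m i := by
    simp [θ, Fintype.linearCombination_apply, smul_tmul']
  have hθsurj (t : A ⊗[R] M) : ∃ x, θ x = t := by
    induction t using TensorProduct.induction_on with
    | zero => exact ⟨0, map_zero θ⟩
    | tmul a y =>
      obtain ⟨r, rfl⟩ := (Submodule.mem_span_range_iff_exists_fun R).mp
        (hm ▸ Submodule.mem_top (x := y))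
      exact ⟨fun i ↦ r i • a, by simp_rw [hθ, tmul_sum, tmul_smul, smul_tmul']⟩
    | add s t hs ht =>
      obtain ⟨⟨x, rfl⟩, ⟨y, rfl⟩⟩ := hs, ht
      exact ⟨x + y, map_add θ x y⟩
  rw [injective_iff_map_eq_zero]
  intro t ht
  obtain ⟨x, rfl⟩ := hθsurj t
  have hx : ∑ i, x i • g (m i) = 0 := by simpa [hθ] using ht
  have hle : Submodule.span A
      {y | ∃ r : ι → R, ∑ i, r i • m i = 0 ∧ y = fun i ↦ algebraMap R A (r i)} ≤
      LinearMap.ker θ := by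
    rw [Submodule.span_le]
    rintro _ ⟨r, hr, rfl⟩
    simp_rw [SetLike.mem_coe, LinearMap.mem_ker, hθ, Algebra.algebraMap_eq_smul_one, smul_tmul,
      ← tmul_sum, hr, tmul_zero]
  exact hle (hrel x hx)

theorem mem_span_of_relations_le {R A M N ι : Type*} [CommRing R] [CommRing A]
    [Algebra R A] [AddCommGroup M] [Module R M] [AddCommGroup N] [Module A N]
    [Fintype ι] {m : ι → M} {n : ι → N} {e : R} (he : e * e = e) (hem : ∀ i, e • m i = m i)
    (hle : relations A e n ≤ Submodule.span A
      {y | ∃ r : ι → R, ∑ i, r i • m i = 0 ∧ y = fun i ↦ algebraMap R A (r i)})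
    {x : ι → A} (hx : ∑ i, x i • n i = 0) :
    x ∈ Submodule.span A
      {y | ∃ r : ι → R, ∑ i, r i • m i = 0 ∧ y = fun i ↦ algebraMap R A (r i)} := by
  classical
  rw [show x = e • x + ∑ i, x i • (fun j ↦ algebraMap R A ((Pi.single i (1 - e) : ι → R) j)) by
    ext j
    simp [Finset.sum_apply, Pi.single_apply, apply_ite (algebraMap R A), Algebra.smul_def]
    ring]
  refine add_mem (hle (smul_mem_relations he hx)) (Submodule.sum_mem _ fun i _ ↦
    Submodule.smul_mem _ _ (Submodule.subset_span ⟨_, ?_, rfl⟩))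
  simp [Pi.single_apply, ite_smul, sub_smul, hem]

end BaseChange

section Glueing

variable {R R1 R2 R12 : Type u} [CommRing R] [CommRing R1] [CommRing R2] [CommRing R12]
  [Algebra R R1] [Algebra R R2] [Algebra R1 R12] [Algebra R2 R12]

/-- Every finite glueing datum in a fixed universe has a finitely generated submodule of its
kernel which generates the first module. -/
def GenerationHypothesis (R R1 R2 R12 : Type u) [CommRing R] [CommRing R1] [CommRing R2]
    [CommRing R12] [Algebra R R1] [Algebra R R2] [Algebra R R12] [Algebra R1 R12]
    [Algebra R2 R12] : Prop :=
  ∀ (N1 N2 N12 : Type v)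
    [AddCommGroup N1] [Module R1 N1] [Module R N1] [IsScalarTower R R1 N1]
    [AddCommGroup N2] [Module R2 N2] [Module R N2] [IsScalarTower R R2 N2]
    [AddCommGroup N12] [Module R12 N12] [Module R N12] [IsScalarTower R R12 N12],
    Module.Finite R1 N1 → Module.Finite R2 N2 → Module.Finite R12 N12 →
    ∀ (ψ1 : (R12 ⊗[R1] N1) ≃ₗ[R12] N12) (ψ2 : (R12 ⊗[R2] N2) ≃ₗ[R12] N12)
      (δ : (N1 × N2) →ₗ[R] N12),
      (∀ m : N1 × N2, δ m = ψ1 ((1 : R12) ⊗ₜ[R1] m.1) - ψ2 ((1 : R12) ⊗ₜ[R2] m.2)) →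
      ∃ M0 : Submodule R (N1 × N2), M0 ≤ LinearMap.ker δ ∧ M0.FG ∧
        Function.Surjective
          (LinearMap.liftBaseChange R1 ((LinearMap.fst R N1 N2).comp M0.subtype))

variable {M1 M2 M12 : Type w}
  [AddCommGroup M1] [Module R1 M1] [Module R M1] [IsScalarTower R R1 M1]
  [AddCommGroup M2] [Module R2 M2] [Module R M2] [IsScalarTower R R2 M2]
  [AddCommGroup M12] [Module R12 M12] {ι : Type} [Fintype ι]

theorem exists_sum_sub_sum_eq
    (hsurj : ∀ z : R12, ∃ (x1 : R1) (x2 : R2), algebraMap R1 R12 x1 - algebraMap R2 R12 x2 = z)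
    (ψ1 : (R12 ⊗[R1] M1) ≃ₗ[R12] M12) (ψ2 : (R12 ⊗[R2] M2) ≃ₗ[R12] M12) {m : ι → M1 × M2}
    (hm : ∀ i, ψ1 (1 ⊗ₜ (m i).1) = ψ2 (1 ⊗ₜ (m i).2))
    (hm1 : Submodule.span R1 (Set.range fun i ↦ (m i).1) = ⊤) (z : M12) :
    ∃ (c : ι → R1) (d : ι → R2), ψ1 (1 ⊗ₜ (∑ i, c i • (m i).1)) -
      ψ2 (1 ⊗ₜ (∑ i, d i • (m i).2)) = z := by
  have hz : ∃ a : ι → R12, ∑ i, a i • ψ1 (1 ⊗ₜ (m i).1) = z := by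
    obtain ⟨t, rfl⟩ := ψ1.surjective z
    induction t using TensorProduct.induction_on with
    | zero => exact ⟨0, by simp⟩
    | tmul b y =>
      obtain ⟨r, rfl⟩ := (Submodule.mem_span_range_iff_exists_fun R1).mp
        (hm1 ▸ Submodule.mem_top (x := y))
      refine ⟨fun i ↦ b * algebraMap R1 R12 (r i), ?_⟩
      rw [← mul_one b, ← smul_eq_mul, ← smul_tmul', map_smul, equiv_one_tmul_sum_smul,
        Finset.smul_sum]
      simp only [smul_eq_mul, mul_one, mul_smul]
    | add s t hs ht =>
      obtain ⟨⟨x, hx⟩, ⟨y, hy⟩⟩ := hs, ht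
      exact ⟨x + y, by simp only [Pi.add_apply, add_smul, Finset.sum_add_distrib, hx, hy, map_add]⟩
  obtain ⟨a, rfl⟩ := hz
  choose c d hcd using fun i ↦ hsurj (a i)
  refine ⟨c, d, ?_⟩
  rw [equiv_one_tmul_sum_smul, equiv_one_tmul_sum_smul, ← Finset.sum_sub_distrib]
  exact Finset.sum_congr rfl fun i _ ↦ by rw [← hm, ← sub_smul, hcd]

theorem exists_generators_of_fst_generators [Module.Finite R2 M2]
    (hsurj : ∀ z : R12, ∃ (x1 : R1) (x2 : R2), algebraMap R1 R12 x1 - algebraMap R2 R12 x2 = z)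
    (ψ1 : (R12 ⊗[R1] M1) ≃ₗ[R12] M12) (ψ2 : (R12 ⊗[R2] M2) ≃ₗ[R12] M12) {m : ι → M1 × M2}
    (hm : ∀ i, ψ1 (1 ⊗ₜ (m i).1) = ψ2 (1 ⊗ₜ (m i).2))
    (hm1 : Submodule.span R1 (Set.range fun i ↦ (m i).1) = ⊤) :
    ∃ (κ : Type) (_ : Fintype κ) (n : κ → M1 × M2),
      (∀ i, ψ1 (1 ⊗ₜ (n i).1) = ψ2 (1 ⊗ₜ (n i).2)) ∧
      Submodule.span R1 (Set.range fun i ↦ (n i).1) = ⊤ ∧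
      Submodule.span R2 (Set.range fun i ↦ (n i).2) = ⊤ := by
  obtain ⟨k, g, hg⟩ := Module.Finite.exists_fin (R := R2) (M := M2)
  choose c d hcd using fun j ↦ exists_sum_sub_sum_eq hsurj ψ1 ψ2 hm hm1 (ψ2 (1 ⊗ₜ g j))
  let n : ι ⊕ Fin k → M1 × M2 :=
    Sum.elim m fun j ↦ (∑ i, c j i • (m i).1, g j + ∑ i, d j i • (m i).2)
  refine ⟨ι ⊕ Fin k, inferInstance, n, ?_, ?_, ?_⟩
  · rintro (i | j)
    · exact hm i
    · change ψ1 (1 ⊗ₜ _) = ψ2 (1 ⊗ₜ (_ + _))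
      rw [tmul_add, map_add, ← hcd, sub_add_cancel]
      rfl
  · rw [eq_top_iff, ← hm1]
    refine Submodule.span_mono ?_
    rintro _ ⟨i, rfl⟩
    exact ⟨.inl i, rfl⟩
  · rw [eq_top_iff, ← hg, Submodule.span_le]
    rintro _ ⟨j, rfl⟩
    have h1 (i : ι) : (m i).2 ∈ Submodule.span R2 (Set.range fun i ↦ (n i).2) :=
      Submodule.subset_span ⟨.inl i, rfl⟩
    have h2 : g j + ∑ i, d j i • (m i).2 ∈ Submodule.span R2 (Set.range fun i ↦ (n i).2) :=
      Submodule.subset_span ⟨.inr j, rfl⟩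
    have h3 := sub_mem h2 (Submodule.sum_mem _ fun i (_ : i ∈ Finset.univ) ↦
      Submodule.smul_mem _ (d j i) (h1 i))
    rwa [add_sub_cancel_right] at h3

theorem exists_glued_idempotent [Algebra R R12] [IsScalarTower R R1 R12] [IsScalarTower R R2 R12]
    (hinj : ∀ r : R, algebraMap R R1 r = 0 → algebraMap R R2 r = 0 → r = 0)
    (hmid : ∀ (x1 : R1) (x2 : R2), algebraMap R1 R12 x1 = algebraMap R2 R12 x2 →
      ∃ r : R, algebraMap R R1 r = x1 ∧ algebraMap R R2 r = x2)
    [Module.Finite R1 M1] [Module.Projective R1 M1] [Module.Finite R2 M2] [Module.Projective R2 M2]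
    (ψ1 : (R12 ⊗[R1] M1) ≃ₗ[R12] M12) (ψ2 : (R12 ⊗[R2] M2) ≃ₗ[R12] M12) :
    ∃ e : R, e * e = e ∧ (∀ x : M1, e • x = x) ∧ (∀ x : M2, e • x = x) ∧
      (∀ a : R1, (∀ x : M1, a • x = 0) → e • a = 0) ∧
      (∀ a : R2, (∀ x : M2, a • x = 0) → e • a = 0) ∧
      (∀ a : R12, (∀ x : M12, a • x = 0) → e • a = 0) := by
  obtain ⟨e1, he1, he1'⟩ := exists_mem_traceIdeal_smul_eq_self (A := R1) (M := M1)
  obtain ⟨e2, he2, he2'⟩ := exists_mem_traceIdeal_smul_eq_self (A := R2) (M := M2)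
  have h1 := eq_mul_of_mem_traceIdeal (algebraMap_smul_eq_self ψ1 he1')
    (algebraMap_mem_traceIdeal ψ2 he2)
  have h2 := eq_mul_of_mem_traceIdeal (algebraMap_smul_eq_self ψ2 he2')
    (algebraMap_mem_traceIdeal ψ1 he1)
  obtain ⟨e, rfl, rfl⟩ := hmid e1 e2 (by rw [h2, mul_comm, ← h1])
  have he : e * e - e = 0 := by
    apply hinj <;> rw [map_sub, map_mul, sub_eq_zero]
    · exact (eq_mul_of_mem_traceIdeal he1' he1).symm
    · exact (eq_mul_of_mem_traceIdeal he2' he2).symm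
  refine ⟨e, sub_eq_zero.mp he, fun x ↦ ?_, fun x ↦ ?_, fun a ha ↦ ?_, fun a ha ↦ ?_,
    fun a ha ↦ ?_⟩
  · rw [← algebraMap_smul R1, he1']
  · rw [← algebraMap_smul R2, he2']
  · rw [Algebra.smul_def, mul_comm, mul_eq_zero_of_mem_traceIdeal ha he1]
  · rw [Algebra.smul_def, mul_comm, mul_eq_zero_of_mem_traceIdeal ha he2]
  · rw [Algebra.smul_def, mul_comm, IsScalarTower.algebraMap_apply R R1 R12,
      mul_eq_zero_of_mem_traceIdeal ha (algebraMap_mem_traceIdeal ψ1 he1)]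

theorem exists_mem_relations_of_algebraMap_eq
    (hinj : ∀ r : R, algebraMap R R1 r = 0 → algebraMap R R2 r = 0 → r = 0)
    (hmid : ∀ (x1 : R1) (x2 : R2), algebraMap R1 R12 x1 = algebraMap R2 R12 x2 →
      ∃ r : R, algebraMap R R1 r = x1 ∧ algebraMap R R2 r = x2)
    {e : R} {m : ι → M1 × M2} {x : ι → R1} {y : ι → R2}
    (hx : x ∈ relations R1 e fun i ↦ (m i).1) (hy : y ∈ relations R2 e fun i ↦ (m i).2)
    (hxy : ∀ i, algebraMap R1 R12 (x i) = algebraMap R2 R12 (y i)) :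
    ∃ r ∈ relations R e m, (∀ i, algebraMap R R1 (r i) = x i) ∧
      ∀ i, algebraMap R R2 (r i) = y i := by
  choose r hr1 hr2 using fun i ↦ hmid _ _ (hxy i)
  refine ⟨r, ⟨funext fun i ↦ sub_eq_zero.mp ?_, Prod.ext ?_ ?_⟩, hr1, hr2⟩
  · apply hinj <;> rw [Pi.smul_apply, smul_eq_mul, map_sub, map_mul, sub_eq_zero,
      ← Algebra.smul_def]
    · rw [hr1]; exact congr_fun hx.1 i
    · rw [hr2]; exact congr_fun hy.1 i
  · rw [Prod.fst_sum, Prod.fst_zero, ← hx.2]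
    exact Finset.sum_congr rfl fun i _ ↦ by rw [Prod.smul_fst, ← hr1, algebraMap_smul]
  · rw [Prod.snd_sum, Prod.snd_zero, ← hy.2]
    exact Finset.sum_congr rfl fun i _ ↦ by rw [Prod.smul_snd, ← hr2, algebraMap_smul]

variable [Algebra R R12] [IsScalarTower R R1 R12] [IsScalarTower R R2 R12]

section

variable [Module R M12] [IsScalarTower R R12 M12]

/-- The difference map of a glueing datum, whose kernel is the glued module. -/
def glueingMap (ψ1 : (R12 ⊗[R1] M1) ≃ₗ[R12] M12) (ψ2 : (R12 ⊗[R2] M2) ≃ₗ[R12] M12) :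
    (M1 × M2) →ₗ[R] M12 where
  toFun m := ψ1 (1 ⊗ₜ m.1) - ψ2 (1 ⊗ₜ m.2)
  map_add' x y := by simp only [Prod.fst_add, Prod.snd_add, tmul_add, map_add]; abel
  map_smul' r x := by
    rw [Prod.smul_fst, Prod.smul_snd, ← algebraMap_smul R1 r x.1, ← algebraMap_smul R2 r x.2,
      equiv_one_tmul_smul, equiv_one_tmul_smul, ← IsScalarTower.algebraMap_apply,
      ← IsScalarTower.algebraMap_apply, algebraMap_smul, algebraMap_smul, RingHom.id_apply,
      smul_sub]

theorem span_range_eq_ker_glueingMap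
    (hmid : ∀ (x1 : R1) (x2 : R2), algebraMap R1 R12 x1 = algebraMap R2 R12 x2 →
      ∃ r : R, algebraMap R R1 r = x1 ∧ algebraMap R R2 r = x2)
    (ψ1 : (R12 ⊗[R1] M1) ≃ₗ[R12] M12) (ψ2 : (R12 ⊗[R2] M2) ≃ₗ[R12] M12)
    {e : R} (he : e * e = e) (he1 : ∀ x : M1, e • x = x) (he2 : ∀ x : M2, e • x = x)
    {m : ι → M1 × M2} (hm : ∀ i, ψ1 (1 ⊗ₜ (m i).1) = ψ2 (1 ⊗ₜ (m i).2))
    (hm1 : Submodule.span R1 (Set.range fun i ↦ (m i).1) = ⊤)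
    (hm2 : Submodule.span R2 (Set.range fun i ↦ (m i).2) = ⊤)
    (hdiff : ∀ z ∈ relations R12 e fun i ↦ ψ1 (1 ⊗ₜ (m i).1),
      ∃ x ∈ relations R1 e fun i ↦ (m i).1, ∃ y ∈ relations R2 e fun i ↦ (m i).2,
        ∀ i, algebraMap R1 R12 (x i) - algebraMap R2 R12 (y i) = z i) :
    Submodule.span R (Set.range m) = LinearMap.ker (glueingMap (R := R) ψ1 ψ2) := by
  apply le_antisymm
  · rw [Submodule.span_le]
    rintro _ ⟨i, rfl⟩
    exact sub_eq_zero.mpr (hm i)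
  rintro ⟨a, b⟩ (hab : ψ1 (1 ⊗ₜ a) - ψ2 (1 ⊗ₜ b) = 0)
  obtain ⟨x, hx⟩ := (Submodule.mem_span_range_iff_exists_fun R1).mp
    (hm1 ▸ Submodule.mem_top (x := a))
  obtain ⟨y, hy⟩ := (Submodule.mem_span_range_iff_exists_fun R2).mp
    (hm2 ▸ Submodule.mem_top (x := b))
  let z : ι → R12 := fun i ↦ algebraMap R1 R12 (x i) - algebraMap R2 R12 (y i)
  have hz : ∑ i, z i • ψ1 (1 ⊗ₜ (m i).1) = 0 := by
    simp only [z, sub_smul, Finset.sum_sub_distrib]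
    rw [← equiv_one_tmul_sum_smul, hx]
    simp_rw [hm]
    rw [← equiv_one_tmul_sum_smul, hy, hab]
  obtain ⟨x', hx', y', hy', hxy⟩ := hdiff _ (smul_mem_relations he hz)
  choose r hr1 hr2 using fun i ↦ hmid (e • x i - x' i) (e • y i - y' i) (by
    have := hxy i
    simp only [z, Pi.smul_apply, Algebra.smul_def] at this
    simp only [map_sub, Algebra.smul_def, map_mul, ← IsScalarTower.algebraMap_apply]
    linear_combination -this)
  refine (Submodule.mem_span_range_iff_exists_fun R).mpr ⟨r, Prod.ext ?_ ?_⟩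
  · rw [Prod.fst_sum]
    calc ∑ i, (r i • m i).1 = ∑ i, (e • (x i • (m i).1) - x' i • (m i).1) :=
          Finset.sum_congr rfl fun i _ ↦ by
            rw [Prod.smul_fst, ← algebraMap_smul R1, hr1, sub_smul, smul_assoc]
      _ = a := by rw [Finset.sum_sub_distrib, ← Finset.smul_sum, hx, hx'.2, he1, sub_zero]
  · rw [Prod.snd_sum]
    calc ∑ i, (r i • m i).2 = ∑ i, (e • (y i • (m i).2) - y' i • (m i).2) :=
          Finset.sum_congr rfl fun i _ ↦ by
            rw [Prod.smul_snd, ← algebraMap_smul R2, hr2, sub_smul, smul_assoc]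
      _ = b := by rw [Finset.sum_sub_distrib, ← Finset.smul_sum, hy, hy'.2, he2, sub_zero]

/-- The generation hypothesis applies to glueing data in any universe, as long as the modules are
small in the universe of the hypothesis. -/
theorem GenerationHypothesis.exists_generators
    (H : GenerationHypothesis.{u, v} R R1 R2 R12)
    (hsurj : ∀ z : R12, ∃ (x1 : R1) (x2 : R2), algebraMap R1 R12 x1 - algebraMap R2 R12 x2 = z)
    [Small.{v} M1] [Small.{v} M2] [Small.{v} M12] [Module.Finite R1 M1] [Module.Finite R2 M2]
    (ψ1 : (R12 ⊗[R1] M1) ≃ₗ[R12] M12) (ψ2 : (R12 ⊗[R2] M2) ≃ₗ[R12] M12) :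
    ∃ (κ : Type) (_ : Fintype κ) (n : κ → M1 × M2),
      (∀ i, ψ1 (1 ⊗ₜ (n i).1) = ψ2 (1 ⊗ₜ (n i).2)) ∧
      Submodule.span R1 (Set.range fun i ↦ (n i).1) = ⊤ ∧
      Submodule.span R2 (Set.range fun i ↦ (n i).2) = ⊤ := by
  let s1 := Shrink.linearEquiv.{v} R1 M1
  let s2 := Shrink.linearEquiv.{v} R2 M2
  let s12 := Shrink.linearEquiv.{v} R12 M12
  have : IsScalarTower R R1 (Shrink.{v} M1) :=
    ⟨fun a b x ↦ (equivShrink M1).symm.injective (by simp)⟩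
  have : IsScalarTower R R2 (Shrink.{v} M2) :=
    ⟨fun a b x ↦ (equivShrink M2).symm.injective (by simp)⟩
  have : IsScalarTower R R12 (Shrink.{v} M12) :=
    ⟨fun a b x ↦ (equivShrink M12).symm.injective (by simp)⟩
  have : Module.Finite R12 M12 := Module.Finite.equiv ψ1
  let φ1 := (s1.baseChange R1 R12 _ _) ≪≫ₗ ψ1 ≪≫ₗ s12.symm
  let φ2 := (s2.baseChange R2 R12 _ _) ≪≫ₗ ψ2 ≪≫ₗ s12.symm
  obtain ⟨M0, hM0, hfg, hM0surj⟩ := H (Shrink.{v} M1) (Shrink.{v} M2) (Shrink.{v} M12)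
    (.equiv s1.symm) (.equiv s2.symm) (.equiv s12.symm) φ1 φ2 (glueingMap φ1 φ2) fun _ ↦ rfl
  obtain ⟨k, n, rfl⟩ := Submodule.fg_iff_exists_fin_generating_family.mp hfg
  refine exists_generators_of_fst_generators hsurj ψ1 ψ2
    (m := fun i ↦ (s1 (n i).1, s2 (n i).2)) (fun i ↦ ?_) ?_
  · have h : φ1 (1 ⊗ₜ (n i).1) - φ2 (1 ⊗ₜ (n i).2) = 0 := hM0 (Submodule.subset_span ⟨i, rfl⟩)
    exact s12.symm.injective (sub_eq_zero.mp h)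
  · have h1 : Submodule.span R1 (Set.range fun i ↦ (n i).1) = ⊤ := by
      rw [← LinearMap.range_eq_top, LinearMap.range_liftBaseChange, LinearMap.range_comp,
        Submodule.range_subtype, Submodule.map_span, Submodule.span_span_of_tower,
        ← Set.range_comp] at hM0surj
      exact hM0surj
    rw [show (Set.range fun i ↦ s1 (n i).1) = s1 '' Set.range fun i ↦ (n i).1 from
      Set.range_comp s1 _, ← LinearEquiv.coe_coe, ← Submodule.map_span, h1, Submodule.map_top,
      LinearEquiv.range]

end

variable [Small.{v} M1] [Small.{v} M2] [Small.{v} M12]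
  [Module.Projective R1 M1] [Module.Projective R2 M2]

theorem GenerationHypothesis.exists_relation_generators
    (H : GenerationHypothesis.{u, v} R R1 R2 R12)
    (hinj : ∀ r : R, algebraMap R R1 r = 0 → algebraMap R R2 r = 0 → r = 0)
    (hmid : ∀ (x1 : R1) (x2 : R2), algebraMap R1 R12 x1 = algebraMap R2 R12 x2 →
      ∃ r : R, algebraMap R R1 r = x1 ∧ algebraMap R R2 r = x2)
    (hsurj : ∀ z : R12, ∃ (x1 : R1) (x2 : R2), algebraMap R1 R12 x1 - algebraMap R2 R12 x2 = z)
    (ψ1 : (R12 ⊗[R1] M1) ≃ₗ[R12] M12) (ψ2 : (R12 ⊗[R2] M2) ≃ₗ[R12] M12)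
    {e : R} (he : e * e = e)
    (hann1 : ∀ a : R1, (∀ x : M1, a • x = 0) → e • a = 0)
    (hann2 : ∀ a : R2, (∀ x : M2, a • x = 0) → e • a = 0)
    (hann12 : ∀ a : R12, (∀ x : M12, a • x = 0) → e • a = 0)
    {m : ι → M1 × M2} (hm : ∀ i, ψ1 (1 ⊗ₜ (m i).1) = ψ2 (1 ⊗ₜ (m i).2))
    (hm1 : Submodule.span R1 (Set.range fun i ↦ (m i).1) = ⊤)
    (hm2 : Submodule.span R2 (Set.range fun i ↦ (m i).2) = ⊤) :
    (∀ z ∈ relations R12 e fun i ↦ ψ1 (1 ⊗ₜ (m i).1),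
      ∃ x ∈ relations R1 e fun i ↦ (m i).1, ∃ y ∈ relations R2 e fun i ↦ (m i).2,
        ∀ i, algebraMap R1 R12 (x i) - algebraMap R2 R12 (y i) = z i) ∧
    (relations R1 e fun i ↦ (m i).1) ≤ Submodule.span R1
      {y | ∃ r : ι → R, ∑ i, r i • m i = 0 ∧ y = fun i ↦ algebraMap R R1 (r i)} ∧
    (relations R2 e fun i ↦ (m i).2) ≤ Submodule.span R2
      {y | ∃ r : ι → R, ∑ i, r i • m i = 0 ∧ y = fun i ↦ algebraMap R R2 (r i)} := by
  obtain ⟨Φ1, hΦ1⟩ := exists_baseChange_relations_equiv (m' := fun i ↦ ψ1 (1 ⊗ₜ (m i).1))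
    ψ1 he hm1 fun _ ↦ rfl
  obtain ⟨Φ2, hΦ2⟩ := exists_baseChange_relations_equiv (m' := fun i ↦ ψ1 (1 ⊗ₜ (m i).1))
    ψ2 he hm2 hm
  have := small_relations (fun i ↦ (m i).1) hann1
  have := small_relations (fun i ↦ (m i).2) hann2
  have := small_relations (fun i ↦ ψ1 (1 ⊗ₜ (m i).1)) hann12
  have := finite_relations he hm1
  have := finite_relations he hm2
  obtain ⟨κ, _, n, hn, hn1, hn2⟩ := H.exists_generators hsurj Φ1 Φ2
  have hr (k : κ) : ∃ r ∈ relations R e m, (∀ i, algebraMap R R1 (r i) = (n k).1.1 i) ∧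
      ∀ i, algebraMap R R2 (r i) = (n k).2.1 i :=
    exists_mem_relations_of_algebraMap_eq (R12 := R12) hinj hmid (n k).1.2 (n k).2.2 fun i ↦ by
      rw [← hΦ1, ← hΦ2, hn]
  refine ⟨fun z hz ↦ ?_, fun x hx ↦ ?_, fun y hy ↦ ?_⟩
  · obtain ⟨c, d, h⟩ := exists_sum_sub_sum_eq hsurj Φ1 Φ2 hn hn1 ⟨z, hz⟩
    refine ⟨_, (∑ k, c k • (n k).1).2, _, (∑ k, d k • (n k).2).2, fun i ↦ ?_⟩
    rw [← hΦ1, ← hΦ2]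
    exact congr_fun (congr_arg Subtype.val h) i
  · obtain ⟨c, h⟩ := (Submodule.mem_span_range_iff_exists_fun R1).mp
      (hn1 ▸ Submodule.mem_top (x := (⟨x, hx⟩ : relations R1 e fun i ↦ (m i).1)))
    rw [← show ∑ k, c k • (n k).1.1 = x by simpa using congr_arg Subtype.val h]
    refine Submodule.sum_mem _ fun k _ ↦ Submodule.smul_mem _ _ (Submodule.subset_span ?_)
    obtain ⟨r, hr, hr1, -⟩ := hr k
    exact ⟨r, hr.2, funext fun i ↦ (hr1 i).symm⟩
  · obtain ⟨c, h⟩ := (Submodule.mem_span_range_iff_exists_fun R2).mp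
      (hn2 ▸ Submodule.mem_top (x := (⟨y, hy⟩ : relations R2 e fun i ↦ (m i).2)))
    rw [← show ∑ k, c k • (n k).2.1 = y by simpa using congr_arg Subtype.val h]
    refine Submodule.sum_mem _ fun k _ ↦ Submodule.smul_mem _ _ (Submodule.subset_span ?_)
    obtain ⟨r, hr, -, hr2⟩ := hr k
    exact ⟨r, hr.2, funext fun i ↦ (hr2 i).symm⟩

theorem GenerationHypothesis.ker_glueingMap_fg
    (H : GenerationHypothesis.{u, v} R R1 R2 R12)
    (hinj : ∀ r : R, algebraMap R R1 r = 0 → algebraMap R R2 r = 0 → r = 0)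
    (hmid : ∀ (x1 : R1) (x2 : R2), algebraMap R1 R12 x1 = algebraMap R2 R12 x2 →
      ∃ r : R, algebraMap R R1 r = x1 ∧ algebraMap R R2 r = x2)
    (hsurj : ∀ z : R12, ∃ (x1 : R1) (x2 : R2), algebraMap R1 R12 x1 - algebraMap R2 R12 x2 = z)
    [Module R M12] [IsScalarTower R R12 M12] [Module.Finite R1 M1] [Module.Finite R2 M2]
    (ψ1 : (R12 ⊗[R1] M1) ≃ₗ[R12] M12) (ψ2 : (R12 ⊗[R2] M2) ≃ₗ[R12] M12) :
    (LinearMap.ker (glueingMap (R := R) ψ1 ψ2)).FG := by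
  obtain ⟨e, he, he1, he2, hann1, hann2, hann12⟩ := exists_glued_idempotent hinj hmid ψ1 ψ2
  obtain ⟨ι, _, m, hm, hm1, hm2⟩ := H.exists_generators hsurj ψ1 ψ2
  have hrel := H.exists_relation_generators hinj hmid hsurj ψ1 ψ2 he hann1 hann2 hann12 hm hm1 hm2
  rw [← span_range_eq_ker_glueingMap hmid ψ1 ψ2 he he1 he2 hm hm1 hm2 hrel.1]
  exact Submodule.fg_span (Set.finite_range m)

theorem GenerationHypothesis.relations_fg
    (H : GenerationHypothesis.{u, v} R R1 R2 R12)
    (hinj : ∀ r : R, algebraMap R R1 r = 0 → algebraMap R R2 r = 0 → r = 0)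
    (hmid : ∀ (x1 : R1) (x2 : R2), algebraMap R1 R12 x1 = algebraMap R2 R12 x2 →
      ∃ r : R, algebraMap R R1 r = x1 ∧ algebraMap R R2 r = x2)
    (hsurj : ∀ z : R12, ∃ (x1 : R1) (x2 : R2), algebraMap R1 R12 x1 - algebraMap R2 R12 x2 = z)
    (ψ1 : (R12 ⊗[R1] M1) ≃ₗ[R12] M12) (ψ2 : (R12 ⊗[R2] M2) ≃ₗ[R12] M12)
    {e : R} (he : e * e = e)
    (hann1 : ∀ a : R1, (∀ x : M1, a • x = 0) → e • a = 0)
    (hann2 : ∀ a : R2, (∀ x : M2, a • x = 0) → e • a = 0)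
    (hann12 : ∀ a : R12, (∀ x : M12, a • x = 0) → e • a = 0)
    {m : ι → M1 × M2} (hm : ∀ i, ψ1 (1 ⊗ₜ (m i).1) = ψ2 (1 ⊗ₜ (m i).2))
    (hm1 : Submodule.span R1 (Set.range fun i ↦ (m i).1) = ⊤)
    (hm2 : Submodule.span R2 (Set.range fun i ↦ (m i).2) = ⊤) :
    (relations R e m).FG := by
  obtain ⟨Φ1, hΦ1⟩ := exists_baseChange_relations_equiv (m' := fun i ↦ ψ1 (1 ⊗ₜ (m i).1))
    ψ1 he hm1 fun _ ↦ rfl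
  obtain ⟨Φ2, hΦ2⟩ := exists_baseChange_relations_equiv (m' := fun i ↦ ψ1 (1 ⊗ₜ (m i).1))
    ψ2 he hm2 hm
  have := small_relations (fun i ↦ (m i).1) hann1
  have := small_relations (fun i ↦ (m i).2) hann2
  have := small_relations (fun i ↦ ψ1 (1 ⊗ₜ (m i).1)) hann12
  have := finite_relations he hm1
  have := finite_relations he hm2
  have := projective_relations he hm1
  have := projective_relations he hm2
  have hfg := H.ker_glueingMap_fg hinj hmid hsurj Φ1 Φ2
  let f1 : (ι → R) →ₗ[R] (ι → R1) := (Algebra.linearMap R R1).compLeft ι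
  let f2 : (ι → R) →ₗ[R] (ι → R2) := (Algebra.linearMap R R2).compLeft ι
  have hf : Function.Injective (f1.prod f2) := by
    rw [injective_iff_map_eq_zero]
    intro r hr
    exact funext fun i ↦ hinj _ (congr_fun (congr_arg Prod.fst hr) i)
      (congr_fun (congr_arg Prod.snd hr) i)
  let incl := ((relations R1 e fun i ↦ (m i).1).subtype.restrictScalars R).prodMap
    ((relations R2 e fun i ↦ (m i).2).subtype.restrictScalars R)
  have hmap : (relations R e m).map (f1.prod f2) =
      (LinearMap.ker (glueingMap (R := R) Φ1 Φ2)).map incl := by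
    ext ⟨x, y⟩
    constructor
    · rintro ⟨r, hr, h⟩
      obtain ⟨rfl, rfl⟩ := Prod.mk.inj h
      have hr1 : f1 r ∈ relations R1 e fun i ↦ (m i).1 := by
        refine ⟨by rw [← map_smul, hr.1], ?_⟩
        have h := congr_arg Prod.fst hr.2
        rw [Prod.fst_sum] at h
        exact (Finset.sum_congr rfl fun i _ ↦ algebraMap_smul R1 (r i) (m i).1).trans h
      have hr2 : f2 r ∈ relations R2 e fun i ↦ (m i).2 := by
        refine ⟨by rw [← map_smul, hr.1], ?_⟩
        have h := congr_arg Prod.snd hr.2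
        rw [Prod.snd_sum] at h
        exact (Finset.sum_congr rfl fun i _ ↦ algebraMap_smul R2 (r i) (m i).2).trans h
      refine ⟨(⟨_, hr1⟩, ⟨_, hr2⟩), sub_eq_zero.mpr (Subtype.ext (funext fun i ↦ ?_)), rfl⟩
      rw [hΦ1, hΦ2]
      exact (IsScalarTower.algebraMap_apply R R1 R12 (r i)).symm.trans
        (IsScalarTower.algebraMap_apply R R2 R12 (r i))
    · rintro ⟨⟨x', y'⟩, hxy, h⟩
      obtain ⟨rfl, rfl⟩ := Prod.mk.inj h
      obtain ⟨r, hr, hr1, hr2⟩ := exists_mem_relations_of_algebraMap_eq (R12 := R12) hinj hmid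
        x'.2 y'.2 fun i ↦ by rw [← hΦ1, ← hΦ2, sub_eq_zero.mp hxy]
      exact ⟨r, hr, Prod.ext (funext hr1) (funext hr2)⟩
  exact Submodule.fg_of_fg_map_injective (f1.prod f2) hf (hmap ▸ hfg.map incl)

end Glueing

/-- Given a commuting square of rings with
`0 → R → R1 ⊕ R2 → R12 → 0` exact, suppose that for every finite glueing datum
the kernel module contains a finitely generated `R`-submodule surjecting onto the
first factor after base change. Then for every finite projective glueing datum the
kernel module `M` is finitely presented over `R`, and the natural base-change maps
`M ⊗_R R1 → M1` and `M ⊗_R R2 → M2` are bijective. -/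
theorem finite_projective_glueing_of_generation_hypothesis
    (R R1 R2 R12 : Type u) [CommRing R] [CommRing R1] [CommRing R2] [CommRing R12]
    [Algebra R R1] [Algebra R R2] [Algebra R R12]
    [Algebra R1 R12] [Algebra R2 R12]
    [IsScalarTower R R1 R12] [IsScalarTower R R2 R12]
    -- exactness of 0 → R → R1 ⊕ R2 → R12 → 0
    (hinj : ∀ r : R, algebraMap R R1 r = 0 → algebraMap R R2 r = 0 → r = 0)
    (hmid : ∀ (x1 : R1) (x2 : R2), algebraMap R1 R12 x1 = algebraMap R2 R12 x2 →
      ∃ r : R, algebraMap R R1 r = x1 ∧ algebraMap R R2 r = x2)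
    (hsurj : ∀ z : R12, ∃ (x1 : R1) (x2 : R2),
      algebraMap R1 R12 x1 - algebraMap R2 R12 x2 = z)
    -- the generation hypothesis, for every finite glueing datum
    (H : ∀ (N1 N2 N12 : Type v)
      [AddCommGroup N1] [Module R1 N1] [Module R N1] [IsScalarTower R R1 N1]
      [AddCommGroup N2] [Module R2 N2] [Module R N2] [IsScalarTower R R2 N2]
      [AddCommGroup N12] [Module R12 N12] [Module R N12] [IsScalarTower R R12 N12],
      Module.Finite R1 N1 → Module.Finite R2 N2 → Module.Finite R12 N12 →
      ∀ (ψ1 : (R12 ⊗[R1] N1) ≃ₗ[R12] N12) (ψ2 : (R12 ⊗[R2] N2) ≃ₗ[R12] N12)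
        (δ : (N1 × N2) →ₗ[R] N12),
        (∀ m : N1 × N2, δ m = ψ1 ((1 : R12) ⊗ₜ[R1] m.1) - ψ2 ((1 : R12) ⊗ₜ[R2] m.2)) →
        ∃ M0 : Submodule R (N1 × N2), M0 ≤ LinearMap.ker δ ∧ M0.FG ∧
          Function.Surjective
            (LinearMap.liftBaseChange R1 ((LinearMap.fst R N1 N2).comp M0.subtype)))
    -- the finite projective glueing datum
    (M1 M2 M12 : Type v)
    [AddCommGroup M1] [Module R1 M1] [Module R M1] [IsScalarTower R R1 M1]
    [AddCommGroup M2] [Module R2 M2] [Module R M2] [IsScalarTower R R2 M2]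
    [AddCommGroup M12] [Module R12 M12] [Module R M12] [IsScalarTower R R12 M12]
    [Module.Finite R1 M1] [Module.Projective R1 M1]
    [Module.Finite R2 M2] [Module.Projective R2 M2]
    [Module.Finite R12 M12] [Module.Projective R12 M12]
    (ψ1 : (R12 ⊗[R1] M1) ≃ₗ[R12] M12) (ψ2 : (R12 ⊗[R2] M2) ≃ₗ[R12] M12)
    (δ : (M1 × M2) →ₗ[R] M12)
    (hδ : ∀ m : M1 × M2, δ m = ψ1 ((1 : R12) ⊗ₜ[R1] m.1) - ψ2 ((1 : R12) ⊗ₜ[R2] m.2)) :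
    Module.FinitePresentation R (LinearMap.ker δ) ∧
    Function.Bijective
      (LinearMap.liftBaseChange R1
        ((LinearMap.fst R M1 M2).comp (LinearMap.ker δ).subtype)) ∧
    Function.Bijective
      (LinearMap.liftBaseChange R2
        ((LinearMap.snd R M1 M2).comp (LinearMap.ker δ).subtype)) := by
  have hδ' : δ = glueingMap ψ1 ψ2 := LinearMap.ext hδ
  subst hδ'
  have H' : GenerationHypothesis.{u, v} R R1 R2 R12 := H
  obtain ⟨e, he, he1, he2, hann1, hann2, hann12⟩ := exists_glued_idempotent hinj hmid ψ1 ψ2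
  obtain ⟨ι, _, m, hm, hm1, hm2⟩ := H'.exists_generators hsurj ψ1 ψ2
  obtain ⟨hdiff, hle1, hle2⟩ :=
    H'.exists_relation_generators hinj hmid hsurj ψ1 ψ2 he hann1 hann2 hann12 hm hm1 hm2
  have hspan := span_range_eq_ker_glueingMap hmid ψ1 ψ2 he he1 he2 hm hm1 hm2 hdiff
  have hfg := H'.relations_fg hinj hmid hsurj ψ1 ψ2 he hann1 hann2 hann12 hm hm1 hm2
  have hem (i : ι) : e • m i = m i := Prod.ext (he1 _) (he2 _)
  let n : ι → LinearMap.ker (glueingMap (R := R) ψ1 ψ2) := fun i ↦ ⟨m i, sub_eq_zero.mpr (hm i)⟩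
  have hn : Submodule.span R (Set.range n) = ⊤ := by
    apply Submodule.map_injective_of_injective
      (LinearMap.ker (glueingMap (R := R) ψ1 ψ2)).injective_subtype
    rw [Submodule.map_span, ← Set.range_comp, Submodule.map_top, Submodule.range_subtype]
    exact hspan
  have hn0 (r : ι → R) : ∑ i, r i • m i = 0 → ∑ i, r i • n i = 0 := fun h ↦
    Subtype.ext (by simpa [n] using h)
  have hmono (A : Type u) [CommRing A] [Algebra R A] : Submodule.span A
      {y | ∃ r : ι → R, ∑ i, r i • m i = 0 ∧ y = fun i ↦ algebraMap R A (r i)} ≤ Submodule.span A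
      {y | ∃ r : ι → R, ∑ i, r i • n i = 0 ∧ y = fun i ↦ algebraMap R A (r i)} :=
    Submodule.span_mono fun _ ⟨r, hr, hy⟩ ↦ ⟨r, hn0 r hr, hy⟩
  refine ⟨?_, ⟨?_, ?_⟩, ⟨?_, ?_⟩⟩
  · refine Module.finitePresentation_of_surjective (Fintype.linearCombination R n)
      (LinearMap.range_eq_top.mp (by rw [Fintype.range_linearCombination, hn])) ?_
    have hker : LinearMap.ker (Fintype.linearCombination R n) =
        relations R e m ⊔ LinearMap.range ((1 - e) • (LinearMap.id : (ι → R) →ₗ[R] ι → R)) := by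
      apply le_antisymm
      · intro x hx
        rw [LinearMap.mem_ker, Fintype.linearCombination_apply] at hx
        have hx' : ∑ i, x i • m i = 0 := by simpa [n] using congr_arg Subtype.val hx
        exact Submodule.mem_sup.mpr ⟨e • x, smul_mem_relations he hx', (1 - e) • x, ⟨x, rfl⟩,
          by rw [← add_smul, add_sub_cancel, one_smul]⟩
      · refine sup_le (fun x hx ↦ hn0 x hx.2) ?_
        rintro _ ⟨x, rfl⟩
        refine hn0 _ (Finset.sum_eq_zero fun i _ ↦ ?_)
        simp [mul_comm _ (x i), mul_smul, sub_smul, hem]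
    rw [hker]
    exact hfg.sup (Module.Finite.iff_fg.mp inferInstance)
  · exact liftBaseChange_injective_of_relations _ hn fun x hx ↦
      hmono R1 (mem_span_of_relations_le he hem hle1 hx)
  · rw [← LinearMap.range_eq_top, LinearMap.range_liftBaseChange, eq_top_iff, ← hm1]
    refine Submodule.span_mono ?_
    rintro _ ⟨i, rfl⟩
    exact ⟨n i, rfl⟩
  · exact liftBaseChange_injective_of_relations _ hn fun x hx ↦
      hmono R2 (mem_span_of_relations_le he hem hle2 hx)
  · rw [← LinearMap.range_eq_top, LinearMap.range_liftBaseChange, eq_top_iff, ← hm2]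
    refine Submodule.span_mono ?_
    rintro _ ⟨i, rfl⟩
    exact ⟨n i, rfl⟩
end

section
/- Let S be a commutative ring, φ : S → S a ring endomorphism, and M a finitely generated S-module equipped with a semilinear φ-action: an additive map T : M → M satisfying T(s·m) = φ(s)·T(m) for all s ∈ S and m ∈ M, such that the induced S-linear map φ*M → M is bijective, where φ*M = S ⊗_{φ,S} M is the base change of M along φ and the map sends s ⊗ m to s·T(m). Then there exist an integer n ≥ 0, an invertible n×n matrix D over S, and a surjective S-linear map π : Sⁿ → M satisfying π(D·φ(v)) = T(π(v)) for all v ∈ Sⁿ, where φ(v) denotes entrywise application of φ. In other words, M admits a φ-equivariant surjection from a finite free S-module endowed with the semilinear φ-action v ↦ D·φ(v) (which is a semilinear φ-action since D is invertible). -/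
universe u

/-- The block matrix `[[A, 1 - AB], [1, -B]]` is invertible, for all square `A`, `B`. -/
theorem isUnit_fromBlocks_one_sub_mul {R ι : Type*} [CommRing R] [Fintype ι] [DecidableEq ι]
    (A B : Matrix ι ι R) : IsUnit (Matrix.fromBlocks A (1 - A * B) 1 (-B)) := by
  refine ⟨⟨Matrix.fromBlocks A (1 - A * B) 1 (-B), Matrix.fromBlocks B (1 - B * A) 1 (-A), ?_, ?_⟩, rfl⟩ <;>
  · rw [Matrix.fromBlocks_multiply, ← Matrix.fromBlocks_one]
    congr 1 <;> noncomm_ring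

/-- A `φ`-semilinear endomorphism whose image spans `M` lifts along a surjection from a finite
free module to `v ↦ D·φ(v)` with `D` invertible. -/
theorem exists_isUnit_lift_of_span_range_eq_top {S M : Type*} [CommRing S] {φ : S →+* S}
    [AddCommGroup M] [Module S M] [Module.Finite S M] (T : M →ₛₗ[φ] M)
    (hT : Submodule.span S (Set.range T) = ⊤) :
    ∃ (n : ℕ) (D : Matrix (Fin n) (Fin n) S) (π : (Fin n → S) →ₗ[S] M),
      IsUnit D ∧ Function.Surjective π ∧
      ∀ v : Fin n → S, π (D.mulVec fun i => φ (v i)) = T (π v) := by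
  obtain ⟨n, p, hp⟩ := Module.Finite.exists_fin' S M
  let e : Fin n → M := fun i => p (Pi.single i 1)
  have hpe (v : Fin n → S) : p v = ∑ i, v i • e i := by
    conv_lhs => rw [pi_eq_sum_univ' v]
    simp [e]
  let q : (Fin n → S) →ₗ[S] M := Fintype.linearCombination S fun i => T (e i)
  have hqT (v : Fin n → S) : q (fun i => φ (v i)) = T (p v) := by
    simp [q, Fintype.linearCombination_apply, hpe, map_sum]
  have hq : Function.Surjective q := by
    rw [← LinearMap.range_eq_top, eq_top_iff, ← hT, Submodule.span_le]
    rintro _ ⟨m, rfl⟩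
    obtain ⟨v, rfl⟩ := hp m
    exact ⟨_, hqT v⟩
  obtain ⟨a, ha⟩ := Module.projective_lifting_property p q hp
  obtain ⟨b, hb⟩ := Module.projective_lifting_property q p hq
  let A := LinearMap.toMatrix' a
  let B := LinearMap.toMatrix' b
  have hA (w : Fin n → S) : p (A.mulVec w) = q w := by
    rw [← ha, LinearMap.comp_apply, LinearMap.toMatrix'_mulVec]
  have hB (w : Fin n → S) : q (B.mulVec w) = p w := by
    rw [← hb, LinearMap.comp_apply, LinearMap.toMatrix'_mulVec]
  let E : Fin n ⊕ Fin n ≃ Fin (n + n) := finSumFinEquiv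
  refine ⟨n + n, Matrix.reindexAlgEquiv S S E (Matrix.fromBlocks A (1 - A * B) 1 (-B)),
    p ∘ₗ LinearMap.funLeft S S (E ∘ Sum.inl),
    (isUnit_fromBlocks_one_sub_mul A B).map _, ?_, fun v => ?_⟩
  · exact hp.comp
      (LinearMap.funLeft_surjective_of_injective S S _ (E.injective.comp Sum.inl_injective))
  · have key : LinearMap.funLeft S S (E ∘ Sum.inl)
        ((Matrix.reindexAlgEquiv S S E (Matrix.fromBlocks A (1 - A * B) 1 (-B))).mulVec
          fun i => φ (v i)) =
        A.mulVec (fun i => φ (v (E (Sum.inl i)))) +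
          (1 - A * B).mulVec (fun i => φ (v (E (Sum.inr i)))) := by
      ext i
      simp [LinearMap.funLeft_apply, Matrix.mulVec, dotProduct, ← E.sum_comp]
    rw [LinearMap.comp_apply, LinearMap.comp_apply, key, Matrix.sub_mulVec, Matrix.one_mulVec,
      ← Matrix.mulVec_mulVec, map_add, map_sub, hA, hA, hB, sub_self, add_zero]
    exact hqT _

/-- Let `S` be a commutative ring with endomorphism `φ`, and let `M` be
a finitely generated `S`-module with a semilinear `φ`-action `T` (i.e. a `φ`-semilinear
endomorphism whose linearization `φ*M → M` is bijective; here the base change `φ*M` is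
encoded by its universal property as a pair `(P, τ)` with `τ : M → P` `φ`-semilinear and
universal, and `Θ : P →ₗ[S] M` is the linearization of `T`). Then there is a
`φ`-equivariant surjection onto `M` from a finite free `S`-module endowed with the
semilinear `φ`-action `v ↦ D·φ(v)` for some invertible matrix `D` over `S`. -/
theorem semilinear_cover_with_free
    (S : Type u) [CommRing S] (φ : S →+* S)
    (M : Type u) [AddCommGroup M] [Module S M] [Module.Finite S M]
    (T : M →ₛₗ[φ] M)
    (P : Type u) [AddCommGroup P] [Module S P] (τ : M →ₛₗ[φ] P)
    (huniv : ∀ (N : Type u) [AddCommGroup N] [Module S N] (f : M →ₛₗ[φ] N),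
      ∃! g : P →ₗ[S] N, ∀ x : M, g (τ x) = f x)
    (Θ : P →ₗ[S] M) (hΘ : ∀ x : M, Θ (τ x) = T x)
    (hbij : Function.Bijective Θ) :
    ∃ (n : ℕ) (D : Matrix (Fin n) (Fin n) S) (π : (Fin n → S) →ₗ[S] M),
      IsUnit D ∧ Function.Surjective π ∧
      ∀ v : Fin n → S, π (D.mulVec fun i => φ (v i)) = T (π v) := by
  have hτ : Submodule.span S (Set.range τ) = ⊤ := by
    obtain ⟨_, -, h⟩ := huniv (P ⧸ Submodule.span S (Set.range τ)) 0
    rw [← Submodule.ker_mkQ (Submodule.span S (Set.range τ)), LinearMap.ker_eq_top]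
    refine (h _ fun x => ?_).trans (h 0 fun x => rfl).symm
    exact (Submodule.Quotient.mk_eq_zero _).2 (Submodule.subset_span ⟨x, rfl⟩)
  refine exists_isUnit_lift_of_span_range_eq_top T ?_
  have hrange : Set.range T = Θ '' Set.range τ := by
    rw [← Set.range_comp]
    exact congrArg Set.range (funext fun x => (hΘ x).symm)
  rw [hrange, Submodule.span_image, hτ, Submodule.map_top, LinearMap.range_eq_top]
  exact hbij.surjective
end

section
/- Let R be a commutative ring and let I be an ideal of R contained in the Jacobson radical of R. Let S be a commutative ring containing R as a subring such that every element of S is integral over R. Then the ideal IS of S generated by I is contained in the Jacobson radical of S. -/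
/-- If `I` is an ideal of `R` contained in the Jacobson radical of `R`
and `S` is an integral extension of `R` (a commutative ring containing `R` via an
injective algebra map, every element of which is integral over `R`), then the ideal `IS`
of `S` generated by `I` is contained in the Jacobson radical of `S`. -/
theorem ideal_map_le_jacobson_of_integral
    (R S : Type*) [CommRing R] [CommRing S] [Algebra R S]
    (hinj : Function.Injective (algebraMap R S))
    [Algebra.IsIntegral R S]
    (I : Ideal R) (hI : I ≤ Ideal.jacobson ⊥) :
    Ideal.map (algebraMap R S) I ≤ Ideal.jacobson ⊥ := by
  refine le_sInf fun M hM => Ideal.map_le_iff_le_comap.2 (hI.trans ?_)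
  have := hM.2
  exact sInf_le ⟨bot_le, Ideal.isMaximal_comap_of_isIntegral_of_isMaximal M⟩
end
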